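/- Let n be a nonnegative integer and let r, s, k and t be integers with r ≥ n. Then the Fibonacci numbers satisfy (-1)^t · F_k · ∑_{j=0}^{n} F_{k+t}^j · F_t^{r-j} · F_{r(s+k)+s-t-kj} = F_t^{r-n} · F_{k+t}^{n+1} · F_{s(r+1)+k(r-n)} - F_t^{r+1} · F_{(s+k)(r+1)}. -/

import Mathlib

/-- Fibonacci numbers extended to all integer indices:
`F 0 = 0`, `F 1 = 1`, `F n = F (n-1) + F (n-2)` for all `n : ℤ`
(equivalently `F (-n) = (-1)^(n-1) * F n`). -/
def fibZ (n : ℤ) : ℤ :=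
  if 0 ≤ n then Nat.fib n.toNat else (-1) ^ (n.natAbs + 1) * Nat.fib n.natAbs

/-- Lucas numbers extended to all integer indices:
`L 0 = 2`, `L 1 = 1`, `L n = L (n-1) + L (n-2)` for all `n : ℤ`
(equivalently `L (-n) = (-1)^n * L n`). -/
def lucasZ (n : ℤ) : ℤ := fibZ (n - 1) + fibZ (n + 1)

theorem fibZ_eq_fib (n : ℤ) : fibZ n = Int.fib n := by
  rcases le_or_gt 0 n with h | h
  · rw [Int.fib_of_nonneg h]
    simp [fibZ, h]
  · obtain ⟨m, rfl⟩ : ∃ m : ℕ, n = -(m : ℤ) := ⟨n.natAbs, by omega⟩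
    rw [Int.fib_neg_natCast]
    simp [fibZ]

theorem fibZ_key (m k t : ℤ) :
    (-1 : ℚ) ^ t * (fibZ k : ℚ) * (fibZ (m - t) : ℚ)
      = (fibZ (k + t) : ℚ) * fibZ m - (fibZ t : ℚ) * fibZ (m + k) := by
  simp only [fibZ_eq_fib]
  have h1 : (Int.fib (m - t) : ℚ)
      = Int.fib (m - 1) * Int.fib (-t) + Int.fib m * Int.fib (-(t - 1)) := by
    have := Int.fib_add m (-t)
    rw [show m + -t = m - t by ring, show -t + 1 = -(t - 1) by ring] at this
    exact_mod_cast this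
  have h2 : (Int.fib (k + t) : ℚ)
      = Int.fib (t - 1) * Int.fib k + Int.fib t * Int.fib (k + 1) := by
    rw [add_comm k t]
    exact_mod_cast Int.fib_add t k
  have h3 : (Int.fib (m + k) : ℚ)
      = Int.fib (m - 1) * Int.fib k + Int.fib m * Int.fib (k + 1) := by
    exact_mod_cast Int.fib_add m k
  have h4 : (-1 : ℚ) ^ t * (-1 : ℚ) ^ t = 1 := by
    rw [← mul_zpow]; simp
  rw [h1, h2, h3, Int.coe_fib_neg, Int.coe_fib_neg, sub_add_cancel,
    zpow_add_one₀ (by norm_num)]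
  linear_combination (Int.fib k * (Int.fib m * Int.fib (t - 1)
    - Int.fib (m - 1) * Int.fib t) : ℚ) * h4

theorem zpow_succ_nonneg (x : ℚ) (a : ℤ) (ha : 0 ≤ a) : x ^ (a + 1) = x ^ a * x := by
  lift a to ℕ using ha
  exact_mod_cast pow_succ x a

theorem fib_geometric_sum (n : ℕ) (r s k t : ℤ) (hr : (n : ℤ) ≤ r) :
    (-1 : ℚ) ^ t * (fibZ k : ℚ) *
        ∑ j ∈ Finset.range (n + 1),
          (fibZ (k + t) : ℚ) ^ j * (fibZ t : ℚ) ^ (r - (j : ℤ)) *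
            (fibZ (r * (s + k) + s - t - k * (j : ℤ)) : ℚ)
      = (fibZ t : ℚ) ^ (r - (n : ℤ)) * (fibZ (k + t) : ℚ) ^ (n + 1) *
            (fibZ (s * (r + 1) + k * (r - (n : ℤ))) : ℚ)
        - (fibZ t : ℚ) ^ (r + 1) * (fibZ ((s + k) * (r + 1)) : ℚ) := by
  induction n with
  | zero =>
    have key := fibZ_key (s * (r + 1) + k * r) k t
    have hp := zpow_succ_nonneg (fibZ t : ℚ) r (by simpa using hr)
    rw [show s * (r + 1) + k * r - t = r * (s + k) + s - t by ring,
      show s * (r + 1) + k * r + k = (s + k) * (r + 1) by ring] at key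
    simp only [zero_add, Finset.sum_range_one, Nat.cast_zero, sub_zero, mul_zero, pow_zero,
      pow_one, hp]
    linear_combination (fibZ t : ℚ) ^ r * key
  | succ n ih =>
    have hr' : (n : ℤ) + 1 ≤ r := by exact_mod_cast hr
    have ih := ih (by omega)
    have key := fibZ_key (s * (r + 1) + k * (r - (n + 1))) k t
    have hp := zpow_succ_nonneg (fibZ t : ℚ) (r - (n + 1)) (by omega)
    rw [show r - ((n : ℤ) + 1) + 1 = r - n by ring] at hp
    rw [show s * (r + 1) + k * (r - ((n : ℤ) + 1)) - t
        = r * (s + k) + s - t - k * (n + 1) by ring,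
      show s * (r + 1) + k * (r - ((n : ℤ) + 1)) + k = s * (r + 1) + k * (r - n) by ring] at key
    rw [Finset.sum_range_succ, mul_add, ih]
    push_cast
    rw [hp]
    linear_combination (fibZ (k + t) : ℚ) ^ (n + 1) * (fibZ t : ℚ) ^ (r - ((n : ℤ) + 1)) * key
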